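/- There do not exist three partitions of (Fin 4)³, namely (Fin 4)³ = P_1 ⊔ P_2 ⊔ P_3 ⊔ P_4 = Q_1 ⊔ Q_2 ⊔ Q_3 ⊔ Q_4 = R_1 ⊔ R_2 ⊔ R_3 ⊔ R_4, such that for all choices of 1 ≤ i, j, k ≤ 4 the union P_i ∪ Q_j ∪ R_k contains a 3 × 3 × 3 combinatorial cube. -/

import Mathlib

/-- A point of the `4 × 4 × 4` grid. -/
abbrev GridPt : Type := Fin 4 × Fin 4 × Fin 4

/-- A `3 × 3 × 3` combinatorial cube in `(Fin 4)³`: a product `A ×ˢ B ×ˢ C` with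
`|A| = |B| = |C| = 3`. -/
def IsCube (D : Finset GridPt) : Prop :=
  ∃ A B C : Finset (Fin 4), A.card = 3 ∧ B.card = 3 ∧ C.card = 3 ∧ D = A ×ˢ B ×ˢ C

/-- A `2 × 3 × 3` combinatorial prism in `(Fin 4)³`: a product `A ×ˢ B ×ˢ C` whose side
sizes are `2, 3, 3` in some order. -/
def IsPrism233 (D : Finset GridPt) : Prop :=
  ∃ A B C : Finset (Fin 4),
    ({A.card, B.card, C.card} : Multiset ℕ) = ({2, 3, 3} : Multiset ℕ) ∧ D = A ×ˢ B ×ˢ C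

/-- The two-intersection of a family of sets: all points lying in at least two sets of
the family (counted with indices). -/
def twoInter {α : Type*} [Fintype α] [DecidableEq α] {n : ℕ} (S : Fin n → Finset α) :
    Finset α :=
  Finset.univ.filter (fun p => ∃ i j : Fin n, i ≠ j ∧ p ∈ S i ∧ p ∈ S j)

/-! ### Cubes indexed by their excluded point -/

/-- `x` differs from `e` in every coordinate, i.e. `x` is in the cube that excludes `e`. -/
def Miss (x e : GridPt) : Prop := x.1 ≠ e.1 ∧ x.2.1 ≠ e.2.1 ∧ x.2.2 ≠ e.2.2

instance (x e : GridPt) : Decidable (Miss x e) := by unfold Miss; infer_instance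

/-- The cube excluding `e`. -/
def cubeF (e : GridPt) : Finset GridPt := Finset.univ.filter (fun x => Miss x e)

/-- Two-intersection of four cubes. -/
def TT (e : Fin 4 → GridPt) : Finset GridPt := twoInter (fun k => cubeF (e k))

/-- One-dimensional indicator of `a ≠ b`. -/
def al (a b : Fin 4) : ℤ := if a = b then 0 else 1

/-- Indicator of a cube. -/
def ch (e x : GridPt) : ℤ := al x.1 e.1 * al x.2.1 e.2.1 * al x.2.2 e.2.2

def q2 (a b : Fin 4) : ℤ := ∑ t, al t a * al t b
def q3 (a b c : Fin 4) : ℤ := ∑ t, al t a * al t b * al t c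
def q4 (a b c d : Fin 4) : ℤ := ∑ t, al t a * al t b * al t c * al t d

theorem sum_grid (f g h : Fin 4 → ℤ) :
    ∑ x : GridPt, f x.1 * g x.2.1 * h x.2.2 = (∑ t, f t) * (∑ t, g t) * (∑ t, h t) := by
  simp only [Fintype.sum_prod_type, Finset.sum_mul, Finset.mul_sum]
  rw [Finset.sum_comm]
  rw [Finset.sum_comm]
  simp only [Fin.sum_univ_four]
  ring

def Q2 (a b : GridPt) : ℤ := q2 a.1 b.1 * q2 a.2.1 b.2.1 * q2 a.2.2 b.2.2
def Q3 (a b c : GridPt) : ℤ := q3 a.1 b.1 c.1 * q3 a.2.1 b.2.1 c.2.1 * q3 a.2.2 b.2.2 c.2.2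
def Q4 (a b c d : GridPt) : ℤ :=
  q4 a.1 b.1 c.1 d.1 * q4 a.2.1 b.2.1 c.2.1 d.2.1 * q4 a.2.2 b.2.2 c.2.2 d.2.2

theorem sum_ch2 (a b : GridPt) : ∑ x, ch a x * ch b x = Q2 a b := by
  unfold Q2 q2
  rw [← sum_grid]
  exact Finset.sum_congr rfl fun x _ => by unfold ch; ring

theorem sum_ch3 (a b c : GridPt) : ∑ x, ch a x * ch b x * ch c x = Q3 a b c := by
  unfold Q3 q3
  rw [← sum_grid]
  exact Finset.sum_congr rfl fun x _ => by unfold ch; ring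

theorem sum_ch4 (a b c d : GridPt) :
    ∑ x, ch a x * ch b x * ch c x * ch d x = Q4 a b c d := by
  unfold Q4 q4
  rw [← sum_grid]
  exact Finset.sum_congr rfl fun x _ => by unfold ch; ring

theorem ch_eq (e x : GridPt) : ch e x = if x ∈ cubeF e then 1 else 0 := by
  have hm : x ∈ cubeF e ↔ x.1 ≠ e.1 ∧ x.2.1 ≠ e.2.1 ∧ x.2.2 ≠ e.2.2 := by
    unfold cubeF
    rw [Finset.mem_filter]
    exact and_iff_right (Finset.mem_univ _)
  rw [if_congr hm rfl rfl]
  simp only [ch, al]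
  by_cases h1 : x.1 = e.1 <;> by_cases h2 : x.2.1 = e.2.1 <;> by_cases h3 : x.2.2 = e.2.2 <;>
    simp [h1, h2, h3]

theorem card_ind {α : Type*} [Fintype α] [DecidableEq α] (S : Finset α) :
    (S.card : ℤ) = ∑ x, if x ∈ S then (1 : ℤ) else 0 := by
  simp

theorem card_cubeF (e : GridPt) : (cubeF e).card = 27 := by
  have h : ((cubeF e).card : ℤ) = 27 := by
    rw [card_ind]
    simp only [← ch_eq]
    unfold ch
    rw [sum_grid (fun t => al t e.1) (fun t => al t e.2.1) (fun t => al t e.2.2)]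
    have : ∀ a : Fin 4, ∑ t, al t a = 3 := by decide
    simp [this]
  exact_mod_cast h

theorem card_inter (a b : GridPt) : ((cubeF a ∩ cubeF b).card : ℤ) = Q2 a b := by
  rw [card_ind, ← sum_ch2]
  refine Finset.sum_congr rfl fun x _ => ?_
  simp only [ch_eq, Finset.mem_inter]
  by_cases h1 : x ∈ cubeF a <;> by_cases h2 : x ∈ cubeF b <;> simp [h1, h2]

theorem mem_twoInter {α : Type*} [Fintype α] [DecidableEq α] {n : ℕ} (S : Fin n → Finset α)
    (x : α) : x ∈ twoInter S ↔ ∃ i j : Fin n, i ≠ j ∧ x ∈ S i ∧ x ∈ S j := by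
  simp [twoInter]

theorem mem_twoInter4 {α : Type*} [Fintype α] [DecidableEq α] (S : Fin 4 → Finset α)
    (x : α) : x ∈ twoInter S ↔
      (x ∈ S 0 ∧ x ∈ S 1) ∨ (x ∈ S 0 ∧ x ∈ S 2) ∨ (x ∈ S 0 ∧ x ∈ S 3) ∨
      (x ∈ S 1 ∧ x ∈ S 2) ∨ (x ∈ S 1 ∧ x ∈ S 3) ∨ (x ∈ S 2 ∧ x ∈ S 3) := by
  rw [mem_twoInter]
  simp only [Fin.exists_fin_succ, Fin.exists_fin_zero]
  simp
  tauto

/-- Exact size of the two-intersection of four cubes. -/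
theorem card_TT (e : Fin 4 → GridPt) : ((TT e).card : ℤ) =
    (Q2 (e 0) (e 1) + Q2 (e 0) (e 2) + Q2 (e 0) (e 3) + Q2 (e 1) (e 2) + Q2 (e 1) (e 3)
      + Q2 (e 2) (e 3))
    - 2 * (Q3 (e 0) (e 1) (e 2) + Q3 (e 0) (e 1) (e 3) + Q3 (e 0) (e 2) (e 3)
      + Q3 (e 1) (e 2) (e 3)) + 3 * Q4 (e 0) (e 1) (e 2) (e 3) := by
  rw [card_ind]
  simp only [← sum_ch2, ← sum_ch3, ← sum_ch4, Finset.mul_sum, ← Finset.sum_add_distrib,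
    ← Finset.sum_sub_distrib]
  refine Finset.sum_congr rfl fun x _ => ?_
  have hm := mem_twoInter4 (fun k => cubeF (e k)) x
  change x ∈ TT e ↔ _ at hm
  classical
  rw [if_congr hm rfl rfl]
  simp only [ch_eq]
  by_cases h0 : x ∈ cubeF (e 0) <;> by_cases h1 : x ∈ cubeF (e 1) <;>
    by_cases h2 : x ∈ cubeF (e 2) <;> by_cases h3 : x ∈ cubeF (e 3) <;> simp [h0, h1, h2, h3]

/-- Points of cube `a` that lie in none of the cubes `b, c, d`. -/
def bad (a b c d : GridPt) : Finset GridPt := ((cubeF a \ cubeF b) \ cubeF c) \ cubeF d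

theorem card_bad (a b c d : GridPt) : ((bad a b c d).card : ℤ) =
    27 - (Q2 a b + Q2 a c + Q2 a d) + (Q3 a b c + Q3 a b d + Q3 a c d) - Q4 a b c d := by
  have h27 : (27 : ℤ) = ∑ x, ch a x := by
    simp only [ch_eq, ← card_ind, card_cubeF]; norm_num
  rw [card_ind, h27]
  simp only [← sum_ch2, ← sum_ch3, ← sum_ch4, ← Finset.sum_add_distrib,
    ← Finset.sum_sub_distrib]
  refine Finset.sum_congr rfl fun x _ => ?_
  simp only [ch_eq, bad, Finset.mem_sdiff]
  by_cases h0 : x ∈ cubeF a <;> by_cases h1 : x ∈ cubeF b <;>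
    by_cases h2 : x ∈ cubeF c <;> by_cases h3 : x ∈ cubeF d <;> simp [h0, h1, h2, h3]

/-! ### The finite check -/

/-- The eleven one-dimensional intersection numbers of four values. -/
structure Vec where
  p01 : ℤ
  p02 : ℤ
  p03 : ℤ
  p12 : ℤ
  p13 : ℤ
  p23 : ℤ
  t012 : ℤ
  t013 : ℤ
  t023 : ℤ
  t123 : ℤ
  q : ℤ
  deriving DecidableEq

def vec (a b c d : Fin 4) : Vec :=
  ⟨q2 a b, q2 a c, q2 a d, q2 b c, q2 b d, q2 c d, q3 a b c, q3 a b d, q3 a c d, q3 b c d,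
    q4 a b c d⟩

/-- The fifteen possible vectors, one for each equality pattern. -/
def vecs : List Vec :=
  [⟨3, 3, 3, 3, 3, 3, 3, 3, 3, 3, 3⟩,
   ⟨3, 3, 2, 3, 2, 2, 3, 2, 2, 2, 2⟩,
   ⟨3, 2, 3, 2, 3, 2, 2, 3, 2, 2, 2⟩,
   ⟨3, 2, 2, 2, 2, 3, 2, 2, 2, 2, 2⟩,
   ⟨3, 2, 2, 2, 2, 2, 2, 2, 1, 1, 1⟩,
   ⟨2, 3, 3, 2, 2, 3, 2, 2, 3, 2, 2⟩,
   ⟨2, 3, 2, 2, 3, 2, 2, 2, 2, 2, 2⟩,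
   ⟨2, 3, 2, 2, 2, 2, 2, 1, 2, 1, 1⟩,
   ⟨2, 2, 3, 3, 2, 2, 2, 2, 2, 2, 2⟩,
   ⟨2, 2, 2, 3, 3, 3, 2, 2, 2, 3, 2⟩,
   ⟨2, 2, 2, 3, 2, 2, 2, 1, 1, 2, 1⟩,
   ⟨2, 2, 3, 2, 2, 2, 1, 2, 2, 1, 1⟩,
   ⟨2, 2, 2, 2, 3, 2, 1, 2, 1, 2, 1⟩,
   ⟨2, 2, 2, 2, 2, 3, 1, 1, 2, 2, 1⟩,
   ⟨2, 2, 2, 2, 2, 2, 1, 1, 1, 1, 0⟩]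

theorem vec_mem : ∀ a b c d : Fin 4, vec a b c d ∈ vecs := by decide +kernel

/-- The product of three vectors. -/
def vmul (u v w : Vec) : Vec :=
  ⟨u.p01 * v.p01 * w.p01, u.p02 * v.p02 * w.p02, u.p03 * v.p03 * w.p03,
   u.p12 * v.p12 * w.p12, u.p13 * v.p13 * w.p13, u.p23 * v.p23 * w.p23,
   u.t012 * v.t012 * w.t012, u.t013 * v.t013 * w.t013, u.t023 * v.t023 * w.t023,
   u.t123 * v.t123 * w.t123, u.q * v.q * w.q⟩

/-- The size is at least `30` or one of the four cubes is covered up to a point. -/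
def Good (z : Vec) : Prop :=
  30 ≤ (z.p01 + z.p02 + z.p03 + z.p12 + z.p13 + z.p23)
    - 2 * (z.t012 + z.t013 + z.t023 + z.t123) + 3 * z.q ∨
  27 - (z.p01 + z.p02 + z.p03) + (z.t012 + z.t013 + z.t023) - z.q ≤ 1 ∨
  27 - (z.p01 + z.p12 + z.p13) + (z.t012 + z.t013 + z.t123) - z.q ≤ 1 ∨
  27 - (z.p02 + z.p12 + z.p23) + (z.t012 + z.t023 + z.t123) - z.q ≤ 1 ∨
  27 - (z.p03 + z.p13 + z.p23) + (z.t013 + z.t023 + z.t123) - z.q ≤ 1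

instance (z : Vec) : Decidable (Good z) := by unfold Good; infer_instance

theorem good_all : ∀ u ∈ vecs, ∀ v ∈ vecs, ∀ w ∈ vecs, Good (vmul u v w) := by
  decide +kernel

theorem q2_comm : ∀ a b : Fin 4, q2 a b = q2 b a := by decide
theorem q3_perm1 : ∀ a b c : Fin 4, q3 b a c = q3 a b c := by decide
theorem q3_perm2 : ∀ a b c : Fin 4, q3 c a b = q3 a b c := by decide
theorem q4_perm1 (a b c d : Fin 4) : q4 b a c d = q4 a b c d := by
  unfold q4; exact Finset.sum_congr rfl fun x _ => by ring
theorem q4_perm2 (a b c d : Fin 4) : q4 c a b d = q4 a b c d := by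
  unfold q4; exact Finset.sum_congr rfl fun x _ => by ring
theorem q4_perm3 (a b c d : Fin 4) : q4 d a b c = q4 a b c d := by
  unfold q4; exact Finset.sum_congr rfl fun x _ => by ring

/-- Being a cube up to at most one point. -/
def Near (S : Finset GridPt) : Prop := ∃ c p : GridPt, cubeF c ⊆ insert p S

theorem near_of_bad (S : Finset GridPt) (a b c d : GridPt) (h : ((bad a b c d).card : ℤ) ≤ 1)
    (hb : cubeF a ∩ cubeF b ⊆ S) (hc : cubeF a ∩ cubeF c ⊆ S) (hd : cubeF a ∩ cubeF d ⊆ S) :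
    Near S := by
  have hcast : (bad a b c d).card ≤ 1 := by exact_mod_cast h
  obtain ⟨p, hp⟩ := Finset.card_le_one_iff_subset_singleton.1 hcast
  refine ⟨a, p, fun x hx => ?_⟩
  by_cases h1 : x ∈ cubeF b
  · exact Finset.mem_insert_of_mem (hb (Finset.mem_inter.2 ⟨hx, h1⟩))
  by_cases h2 : x ∈ cubeF c
  · exact Finset.mem_insert_of_mem (hc (Finset.mem_inter.2 ⟨hx, h2⟩))
  by_cases h3 : x ∈ cubeF d
  · exact Finset.mem_insert_of_mem (hd (Finset.mem_inter.2 ⟨hx, h3⟩))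
  have hbad : x ∈ bad a b c d := by simp [bad, hx, h1, h2, h3]
  have := Finset.mem_singleton.1 (hp hbad)
  exact Finset.mem_insert.2 (Or.inl this)

theorem inter_sub_TT (e : Fin 4 → GridPt) {i j : Fin 4} (h : i ≠ j) :
    cubeF (e i) ∩ cubeF (e j) ⊆ TT e := by
  intro x hx
  rw [Finset.mem_inter] at hx
  exact (mem_twoInter _ x).2 ⟨i, j, h, hx.1, hx.2⟩

/-- The two-intersection of four cubes has at least 30 points or is almost a cube. -/
theorem TT_dichotomy (e : Fin 4 → GridPt) : 30 ≤ (TT e).card ∨ Near (TT e) := by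
  have hg := good_all _ (vec_mem (e 0).1 (e 1).1 (e 2).1 (e 3).1)
    _ (vec_mem (e 0).2.1 (e 1).2.1 (e 2).2.1 (e 3).2.1)
    _ (vec_mem (e 0).2.2 (e 1).2.2 (e 2).2.2 (e 3).2.2)
  simp only [Good, vmul, vec] at hg
  rcases hg with h | h | h | h | h
  · left
    have := card_TT e
    simp only [Q2, Q3, Q4] at this
    have hcast : (30 : ℤ) ≤ ((TT e).card : ℤ) := by rw [this]; exact h
    exact_mod_cast hcast
  · right
    refine near_of_bad _ (e 0) (e 1) (e 2) (e 3) ?_ (inter_sub_TT e (by decide))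
      (inter_sub_TT e (by decide)) (inter_sub_TT e (by decide))
    rw [card_bad]
    simp only [Q2, Q3, Q4]
    exact h
  · right
    refine near_of_bad _ (e 1) (e 0) (e 2) (e 3) ?_ (inter_sub_TT e (by decide))
      (inter_sub_TT e (by decide)) (inter_sub_TT e (by decide))
    rw [card_bad]
    simp only [Q2, Q3, Q4]
    simp only [q2_comm (e 1).1 (e 0).1, q2_comm (e 1).2.1 (e 0).2.1, q2_comm (e 1).2.2 (e 0).2.2,
      q3_perm1 (e 0).1 (e 1).1, q3_perm1 (e 0).2.1 (e 1).2.1, q3_perm1 (e 0).2.2 (e 1).2.2,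
      q4_perm1 (e 0).1 (e 1).1, q4_perm1 (e 0).2.1 (e 1).2.1, q4_perm1 (e 0).2.2 (e 1).2.2]
    exact h
  · right
    refine near_of_bad _ (e 2) (e 0) (e 1) (e 3) ?_ (inter_sub_TT e (by decide))
      (inter_sub_TT e (by decide)) (inter_sub_TT e (by decide))
    rw [card_bad]
    simp only [Q2, Q3, Q4]
    simp only [q2_comm (e 2).1 (e 0).1, q2_comm (e 2).2.1 (e 0).2.1, q2_comm (e 2).2.2 (e 0).2.2,
      q2_comm (e 2).1 (e 1).1, q2_comm (e 2).2.1 (e 1).2.1, q2_comm (e 2).2.2 (e 1).2.2,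
      q3_perm2 (e 0).1 (e 1).1, q3_perm2 (e 0).2.1 (e 1).2.1, q3_perm2 (e 0).2.2 (e 1).2.2,
      q3_perm1 (e 0).1 (e 2).1, q3_perm1 (e 0).2.1 (e 2).2.1, q3_perm1 (e 0).2.2 (e 2).2.2,
      q3_perm1 (e 1).1 (e 2).1, q3_perm1 (e 1).2.1 (e 2).2.1, q3_perm1 (e 1).2.2 (e 2).2.2,
      q4_perm2 (e 0).1 (e 1).1, q4_perm2 (e 0).2.1 (e 1).2.1, q4_perm2 (e 0).2.2 (e 1).2.2]
    exact h
  · right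
    refine near_of_bad _ (e 3) (e 0) (e 1) (e 2) ?_ (inter_sub_TT e (by decide))
      (inter_sub_TT e (by decide)) (inter_sub_TT e (by decide))
    rw [card_bad]
    simp only [Q2, Q3, Q4]
    simp only [q2_comm (e 3).1, q2_comm (e 3).2.1, q2_comm (e 3).2.2,
      q3_perm2 _ _ (e 3).1, q3_perm2 _ _ (e 3).2.1, q3_perm2 _ _ (e 3).2.2,
      q4_perm3 _ _ _ (e 3).1, q4_perm3 _ _ _ (e 3).2.1, q4_perm3 _ _ _ (e 3).2.2]
    exact h

theorem near_card {S : Finset GridPt} (h : Near S) : 26 ≤ S.card := by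
  obtain ⟨c, p, h⟩ := h
  have h1 := Finset.card_le_card h
  have h2 := Finset.card_insert_le p S
  rw [card_cubeF] at h1
  omega

/-! ### Majority of three cubes -/

def maj (a b c : Finset GridPt) : Finset GridPt := (a ∩ b) ∪ (a ∩ c) ∪ (b ∩ c)

theorem card_maj (a b c : GridPt) : ((maj (cubeF a) (cubeF b) (cubeF c)).card : ℤ) =
    Q2 a b + Q2 a c + Q2 b c - 2 * Q3 a b c := by
  rw [card_ind]
  simp only [← sum_ch2, ← sum_ch3, Finset.mul_sum, ← Finset.sum_add_distrib,
    ← Finset.sum_sub_distrib]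
  refine Finset.sum_congr rfl fun x _ => ?_
  simp only [ch_eq, maj, Finset.mem_union, Finset.mem_inter]
  by_cases h0 : x ∈ cubeF a <;> by_cases h1 : x ∈ cubeF b <;>
    by_cases h2 : x ∈ cubeF c <;> simp [h0, h1, h2]

def vecs3 : List (ℤ × ℤ × ℤ × ℤ) :=
  [(3, 3, 3, 3), (3, 2, 2, 2), (2, 3, 2, 2), (2, 2, 3, 2), (2, 2, 2, 1)]

theorem vec3_mem : ∀ a b c : Fin 4, (q2 a b, q2 a c, q2 b c, q3 a b c) ∈ vecs3 := by
  decide +kernel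

theorem good3 : ∀ u ∈ vecs3, ∀ v ∈ vecs3, ∀ w ∈ vecs3,
    20 ≤ u.1 * v.1 * w.1 + u.2.1 * v.2.1 * w.2.1 + u.2.2.1 * v.2.2.1 * w.2.2.1
      - 2 * (u.2.2.2 * v.2.2.2 * w.2.2.2) := by
  decide +kernel

theorem maj_card (a b c : GridPt) : 20 ≤ (maj (cubeF a) (cubeF b) (cubeF c)).card := by
  have h := good3 _ (vec3_mem a.1 b.1 c.1) _ (vec3_mem a.2.1 b.2.1 c.2.1)
    _ (vec3_mem a.2.2 b.2.2 c.2.2)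
  have h2 := card_maj a b c
  simp only [Q2, Q3] at h2
  have hcast : (20 : ℤ) ≤ ((maj (cubeF a) (cubeF b) (cubeF c)).card : ℤ) := by rw [h2]; exact h
  exact_mod_cast hcast

/-! ### Counting -/

theorem count4 {α : Type*} [Fintype α] [DecidableEq α] (S : Fin 4 → Finset α) :
    (S 0).card + (S 1).card + (S 2).card + (S 3).card ≤
      Fintype.card α + 3 * (twoInter S).card := by
  have key : ((S 0).card : ℤ) + (S 1).card + (S 2).card + (S 3).card ≤
      (Finset.univ : Finset α).card + 3 * (twoInter S).card := by
    simp only [card_ind, Finset.mul_sum, ← Finset.sum_add_distrib]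
    refine Finset.sum_le_sum fun x _ => ?_
    rw [if_congr (mem_twoInter4 S x) rfl rfl]
    by_cases h0 : x ∈ S 0 <;> by_cases h1 : x ∈ S 1 <;> by_cases h2 : x ∈ S 2 <;>
      by_cases h3 : x ∈ S 3 <;> simp [h0, h1, h2, h3]
  rw [Finset.card_univ] at key
  exact_mod_cast key

/-- The two-intersection of four explicitly given sets. -/
def two4 (A B C D : Finset GridPt) : Finset GridPt :=
  (A ∩ B) ∪ (A ∩ C) ∪ (A ∩ D) ∪ (B ∩ C) ∪ (B ∩ D) ∪ (C ∩ D)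

theorem count_two (A B C D : Finset GridPt) :
    A.card + B.card + C.card + D.card ≤ 64 + 2 * (two4 A B C D).card + (A ∩ B).card := by
  have key : (A.card : ℤ) + B.card + C.card + D.card ≤
      (Finset.univ : Finset GridPt).card + 2 * (two4 A B C D).card + (A ∩ B).card := by
    simp only [card_ind, Finset.mul_sum, ← Finset.sum_add_distrib]
    refine Finset.sum_le_sum fun x _ => ?_
    simp only [two4, Finset.mem_union, Finset.mem_inter]
    by_cases h0 : x ∈ A <;> by_cases h1 : x ∈ B <;> by_cases h2 : x ∈ C <;>
      by_cases h3 : x ∈ D <;> simp [h0, h1, h2, h3]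
  have h64 : (Finset.univ : Finset GridPt).card = 64 := by simp
  rw [h64] at key
  exact_mod_cast key

/-! ### Two cubes that differ in exactly one coordinate -/

theorem mem_cubeF {x e : GridPt} :
    x ∈ cubeF e ↔ x.1 ≠ e.1 ∧ x.2.1 ≠ e.2.1 ∧ x.2.2 ≠ e.2.2 := by
  unfold cubeF
  rw [Finset.mem_filter]
  exact and_iff_right (Finset.mem_univ _)

theorem plane_choice (u : Fin 4 → Fin 4) (a b : Fin 4) (hab : a ≠ b) :
    ∃ t, (t = a ∨ t = b) ∧ ∃ k l, k ≠ l ∧ u k ≠ t ∧ u l ≠ t := by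
  have h : ∃ t, (t = a ∨ t = b) ∧
      ((u 0 ≠ t ∧ u 1 ≠ t) ∨ (u 0 ≠ t ∧ u 2 ≠ t) ∨ (u 0 ≠ t ∧ u 3 ≠ t) ∨
        (u 1 ≠ t ∧ u 2 ≠ t) ∨ (u 1 ≠ t ∧ u 3 ≠ t) ∨ (u 2 ≠ t ∧ u 3 ≠ t)) := by
    have hx : ∀ k, u k ≠ a ∨ u k ≠ b := fun k => by
      by_cases hk : u k = a
      · right; rw [hk]; exact hab
      · exact Or.inl hk
    rcases hx 0 with h0 | h0 <;> rcases hx 1 with h1 | h1 <;> rcases hx 2 with h2 | h2 <;>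
      first
      | exact ⟨a, Or.inl rfl, Or.inl ⟨h0, h1⟩⟩
      | exact ⟨b, Or.inr rfl, Or.inl ⟨h0, h1⟩⟩
      | exact ⟨a, Or.inl rfl, Or.inr (Or.inl ⟨h0, h2⟩)⟩
      | exact ⟨b, Or.inr rfl, Or.inr (Or.inl ⟨h0, h2⟩)⟩
      | exact ⟨a, Or.inl rfl, Or.inr (Or.inr (Or.inr (Or.inl ⟨h1, h2⟩)))⟩
      | exact ⟨b, Or.inr rfl, Or.inr (Or.inr (Or.inr (Or.inl ⟨h1, h2⟩)))⟩
  obtain ⟨t, ht, h⟩ := h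
  refine ⟨t, ht, ?_⟩
  rcases h with h | h | h | h | h | h
  · exact ⟨0, 1, by decide, h⟩
  · exact ⟨0, 2, by decide, h⟩
  · exact ⟨0, 3, by decide, h⟩
  · exact ⟨1, 2, by decide, h⟩
  · exact ⟨1, 3, by decide, h⟩
  · exact ⟨2, 3, by decide, h⟩

theorem avoid3 : ∀ a b c : Fin 4, ∃ t, t ≠ a ∧ t ≠ b ∧ t ≠ c := by decide

/-- The symmetric difference of two cubes. -/
def InDiff (x c d : GridPt) : Prop :=
  (x ∈ cubeF c ∧ x ∉ cubeF d) ∨ (x ∈ cubeF d ∧ x ∉ cubeF c)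

theorem diff1 (e : Fin 4 → GridPt) (c d : GridPt) (h1 : c.1 ≠ d.1) (h2 : c.2.1 = d.2.1)
    (h3 : c.2.2 = d.2.2) : ∃ x ∈ TT e, InDiff x c d := by
  obtain ⟨t, ht, k, l, hkl, hk, hl⟩ := plane_choice (fun k => (e k).1) c.1 d.1 h1
  obtain ⟨y, y1, y2, y3⟩ := avoid3 (e k).2.1 (e l).2.1 c.2.1
  obtain ⟨z, z1, z2, z3⟩ := avoid3 (e k).2.2 (e l).2.2 c.2.2
  refine ⟨(t, y, z), (mem_twoInter _ _).2
    ⟨k, l, hkl, mem_cubeF.2 ⟨hk.symm, y1, z1⟩, mem_cubeF.2 ⟨hl.symm, y2, z2⟩⟩, ?_⟩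
  unfold InDiff
  simp only [mem_cubeF, ← h2, ← h3]
  rcases ht with rfl | rfl
  · right; simp [h1, y3, z3]
  · left; simp [h1.symm, y3, z3]

theorem diff2 (e : Fin 4 → GridPt) (c d : GridPt) (h1 : c.1 = d.1) (h2 : c.2.1 ≠ d.2.1)
    (h3 : c.2.2 = d.2.2) : ∃ x ∈ TT e, InDiff x c d := by
  obtain ⟨t, ht, k, l, hkl, hk, hl⟩ := plane_choice (fun k => (e k).2.1) c.2.1 d.2.1 h2
  obtain ⟨y, y1, y2, y3⟩ := avoid3 (e k).1 (e l).1 c.1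
  obtain ⟨z, z1, z2, z3⟩ := avoid3 (e k).2.2 (e l).2.2 c.2.2
  refine ⟨(y, t, z), (mem_twoInter _ _).2
    ⟨k, l, hkl, mem_cubeF.2 ⟨y1, hk.symm, z1⟩, mem_cubeF.2 ⟨y2, hl.symm, z2⟩⟩, ?_⟩
  unfold InDiff
  simp only [mem_cubeF, ← h1, ← h3]
  rcases ht with rfl | rfl
  · right; simp [h2, y3, z3]
  · left; simp [h2.symm, y3, z3]

theorem diff3 (e : Fin 4 → GridPt) (c d : GridPt) (h1 : c.1 = d.1) (h2 : c.2.1 = d.2.1)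
    (h3 : c.2.2 ≠ d.2.2) : ∃ x ∈ TT e, InDiff x c d := by
  obtain ⟨t, ht, k, l, hkl, hk, hl⟩ := plane_choice (fun k => (e k).2.2) c.2.2 d.2.2 h3
  obtain ⟨y, y1, y2, y3⟩ := avoid3 (e k).1 (e l).1 c.1
  obtain ⟨z, z1, z2, z3⟩ := avoid3 (e k).2.1 (e l).2.1 c.2.1
  refine ⟨(y, z, t), (mem_twoInter _ _).2
    ⟨k, l, hkl, mem_cubeF.2 ⟨y1, z1, hk.symm⟩, mem_cubeF.2 ⟨y2, z2, hl.symm⟩⟩, ?_⟩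
  unfold InDiff
  simp only [mem_cubeF, ← h1, ← h2]
  rcases ht with rfl | rfl
  · right; simp [h3, y3, z3]
  · left; simp [h3.symm, y3, z3]

theorem two4_of_diff (c d : GridPt) (S T : Finset GridPt) (hcd : (cubeF c ∩ cubeF d).card = 18)
    (h : ∃ x ∈ S, InDiff x c d) : 19 ≤ (two4 (cubeF c) (cubeF d) S T).card := by
  obtain ⟨x, hx, hd⟩ := h
  have hn : x ∉ cubeF c ∩ cubeF d := by
    rw [Finset.mem_inter]
    rcases hd with hd | hd <;> tauto
  have hs : insert x (cubeF c ∩ cubeF d) ⊆ two4 (cubeF c) (cubeF d) S T := by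
    intro y hy
    simp only [two4, Finset.mem_union, Finset.mem_inter]
    rcases Finset.mem_insert.1 hy with rfl | hy
    · rcases hd with hd | hd <;> tauto
    · rw [Finset.mem_inter] at hy; tauto
  have := Finset.card_le_card hs
  rw [Finset.card_insert_of_notMem hn, hcd] at this
  exact this

theorem q2_ne : ∀ a b : Fin 4, a ≠ b → q2 a b = 2 := by decide
theorem q2_eq : ∀ a : Fin 4, q2 a a = 3 := by decide

/-- Two cubes and two large two-intersections. -/
theorem two_cubes (c d : GridPt) (e f : Fin 4 → GridPt) (he : 30 ≤ (TT e).card)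
    (hf : 30 ≤ (TT f).card) : 19 ≤ (two4 (cubeF c) (cubeF d) (TT e) (TT f)).card := by
  have hq := card_inter c d
  have hc := count_two (cubeF c) (cubeF d) (TT e) (TT f)
  rw [card_cubeF, card_cubeF] at hc
  have hsub : (cubeF c ∩ cubeF d).card ≤ (two4 (cubeF c) (cubeF d) (TT e) (TT f)).card := by
    apply Finset.card_le_card
    intro x hx
    rw [Finset.mem_inter] at hx
    simp only [two4, Finset.mem_union, Finset.mem_inter]
    tauto
  unfold Q2 at hq
  by_cases h1 : c.1 = d.1 <;> by_cases h2 : c.2.1 = d.2.1 <;> by_cases h3 : c.2.2 = d.2.2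
  · rw [h1, h2, h3, q2_eq, q2_eq, q2_eq] at hq
    omega
  · rw [h1, h2, q2_eq, q2_eq, q2_ne _ _ h3] at hq
    exact two4_of_diff c d _ _ (by omega) (diff3 e c d h1 h2 h3)
  · rw [h1, h3, q2_eq, q2_eq, q2_ne _ _ h2] at hq
    exact two4_of_diff c d _ _ (by omega) (diff2 e c d h1 h2 h3)
  · rw [h1, q2_eq, q2_ne _ _ h2, q2_ne _ _ h3] at hq
    omega
  · rw [h2, h3, q2_eq, q2_eq, q2_ne _ _ h1] at hq
    exact two4_of_diff c d _ _ (by omega) (diff1 e c d h1 h2 h3)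
  · rw [h2, q2_eq, q2_ne _ _ h1, q2_ne _ _ h3] at hq
    omega
  · rw [h3, q2_eq, q2_ne _ _ h1, q2_ne _ _ h2] at hq
    omega
  · rw [q2_ne _ _ h1, q2_ne _ _ h2, q2_ne _ _ h3] at hq
    omega

/-! ### The iterated two-intersection has at least 17 points -/

theorem near_three (S : Fin 4 → Finset GridPt) {i j k : Fin 4} (hij : i ≠ j) (hik : i ≠ k)
    (hjk : j ≠ k) (hi : Near (S i)) (hj : Near (S j)) (hk : Near (S k)) :
    17 ≤ (twoInter S).card := by
  obtain ⟨a, p, ha⟩ := hi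
  obtain ⟨b, q, hb⟩ := hj
  obtain ⟨c, r, hc⟩ := hk
  have hs : maj (cubeF a) (cubeF b) (cubeF c) ⊆
      insert p (insert q (insert r (twoInter S))) := by
    intro x hx
    simp only [maj, Finset.mem_union, Finset.mem_inter] at hx
    have ha' := @ha x
    have hb' := @hb x
    have hc' := @hc x
    simp only [Finset.mem_insert] at ha' hb' hc' ⊢
    have w1 : x ∈ S i → x ∈ S j → x ∈ twoInter S :=
      fun u v => (mem_twoInter S x).2 ⟨i, j, hij, u, v⟩
    have w2 : x ∈ S i → x ∈ S k → x ∈ twoInter S :=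
      fun u v => (mem_twoInter S x).2 ⟨i, k, hik, u, v⟩
    have w3 : x ∈ S j → x ∈ S k → x ∈ twoInter S :=
      fun u v => (mem_twoInter S x).2 ⟨j, k, hjk, u, v⟩
    grind
  have h0 := Finset.card_le_card hs
  have h1 := Finset.card_insert_le p (insert q (insert r (twoInter S)))
  have h2 := Finset.card_insert_le q (insert r (twoInter S))
  have h3 := Finset.card_insert_le r (twoInter S)
  have h4 := maj_card a b c
  omega

theorem others : ∀ i j : Fin 4, i ≠ j →
    ∃ k l, k ≠ l ∧ i ≠ k ∧ i ≠ l ∧ j ≠ k ∧ j ≠ l := by decide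

theorem near_two (e : Fin 4 → Fin 4 → GridPt) {i j : Fin 4} (hij : i ≠ j)
    (hi : Near (TT (e i))) (hj : Near (TT (e j))) :
    17 ≤ (twoInter (fun j => TT (e j))).card := by
  obtain ⟨k, l, hkl, hik, hil, hjk, hjl⟩ := others i j hij
  rcases TT_dichotomy (e k) with hk | hk
  swap
  · exact near_three (fun j => TT (e j)) hij hik hjk hi hj hk
  rcases TT_dichotomy (e l) with hl | hl
  swap
  · exact near_three (fun j => TT (e j)) hij hil hjl hi hj hl
  obtain ⟨a, p, ha⟩ := hi
  obtain ⟨b, q, hb⟩ := hj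
  have hs : two4 (cubeF a) (cubeF b) (TT (e k)) (TT (e l)) ⊆
      insert p (insert q (twoInter (fun j => TT (e j)))) := by
    intro x hx
    simp only [two4, Finset.mem_union, Finset.mem_inter] at hx
    have ha' := @ha x
    have hb' := @hb x
    simp only [Finset.mem_insert] at ha' hb' ⊢
    have w : ∀ m n : Fin 4, m ≠ n → x ∈ TT (e m) → x ∈ TT (e n) →
        x ∈ twoInter (fun j => TT (e j)) :=
      fun m n h u v => (mem_twoInter _ x).2 ⟨m, n, h, u, v⟩
    have w1 := w i j hij
    have w2 := w i k hik
    have w3 := w i l hil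
    have w4 := w j k hjk
    have w5 := w j l hjl
    have w6 := w k l hkl
    clear w
    grind
  have h0 := Finset.card_le_card hs
  have h1 := Finset.card_insert_le p (insert q (twoInter (fun j => TT (e j))))
  have h2 := Finset.card_insert_le q (twoInter (fun j => TT (e j)))
  have h4 := two_cubes a b (e k) (e l) hk hl
  omega

theorem iterated (e : Fin 4 → Fin 4 → GridPt) :
    17 ≤ (twoInter (fun j => TT (e j))).card := by
  by_cases hn : ∃ i j : Fin 4, i ≠ j ∧ Near (TT (e i)) ∧ Near (TT (e j))
  · obtain ⟨i, j, hij, hi, hj⟩ := hn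
    exact near_two e hij hi hj
  · have h26 : ∀ j, 26 ≤ (TT (e j)).card := fun j => by
      rcases TT_dichotomy (e j) with h | h
      · omega
      · exact near_card h
    have h30 : ∀ i j : Fin 4, i ≠ j → 30 ≤ (TT (e i)).card ∨ 30 ≤ (TT (e j)).card := by
      intro i j hij
      rcases TT_dichotomy (e i) with h | h
      · exact Or.inl h
      rcases TT_dichotomy (e j) with hcast | hcast
      · exact Or.inr hcast
      exact absurd ⟨i, j, hij, h, hcast⟩ hn
    have hc := count4 (fun j => TT (e j))
    have h64 : Fintype.card GridPt = 64 := by simp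
    rw [h64] at hc
    have a0 := h26 0
    have a1 := h26 1
    have a2 := h26 2
    have a3 := h26 3
    have b01 := h30 0 1 (by decide)
    have b02 := h30 0 2 (by decide)
    have b03 := h30 0 3 (by decide)
    have b12 := h30 1 2 (by decide)
    have b13 := h30 1 3 (by decide)
    have b23 := h30 2 3 (by decide)
    omega

/-! ### The theorem -/

theorem card3 : ∀ A : Finset (Fin 4), A.card = 3 → ∃ p, ∀ a, a ≠ p → a ∈ A := by
  decide +kernel

theorem exists_cubeF {D : Finset GridPt} (h : IsCube D) : ∃ e, cubeF e ⊆ D := by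
  obtain ⟨A, B, C, hA, hB, hC, rfl⟩ := h
  obtain ⟨p, hp⟩ := card3 A hA
  obtain ⟨q, hq⟩ := card3 B hB
  obtain ⟨r, hr⟩ := card3 C hC
  refine ⟨(p, q, r), fun x hx => ?_⟩
  obtain ⟨h1, h2, h3⟩ := mem_cubeF.1 hx
  exact Finset.mem_product.2 ⟨hp _ h1, Finset.mem_product.2 ⟨hq _ h2, hr _ h3⟩⟩

/-- There are no three partitions `P, Q, R` of `(Fin 4)³` into four parts each such
that every union `P i ∪ Q j ∪ R k` contains a `3 × 3 × 3` combinatorial cube. -/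
theorem no_three_partitions :
    ¬ ∃ P Q R : Fin 4 → Finset GridPt,
        (∀ x : GridPt, ∃! i, x ∈ P i) ∧
        (∀ x : GridPt, ∃! j, x ∈ Q j) ∧
        (∀ x : GridPt, ∃! k, x ∈ R k) ∧
        (∀ i j k : Fin 4, ∃ D : Finset GridPt, IsCube D ∧ D ⊆ P i ∪ Q j ∪ R k) := by
  rintro ⟨P, Q, R, hP, hQ, hR, h⟩
  have hex : ∀ i j k : Fin 4, ∃ e, cubeF e ⊆ P i ∪ Q j ∪ R k := by
    intro i j k
    obtain ⟨D, hD, hs⟩ := h i j k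
    obtain ⟨e, he⟩ := exists_cubeF hD
    exact ⟨e, he.trans hs⟩
  choose e he using hex
  have hT : ∀ i j, TT (e i j) ⊆ P i ∪ Q j := by
    intro i j x hx
    obtain ⟨k, l, hkl, hk, hl⟩ := (mem_twoInter _ x).1 hx
    by_contra hno
    have hk' := he i j k hk
    have hl' := he i j l hl
    rw [Finset.mem_union] at hk' hl'
    exact hkl ((hR x).unique (hk'.resolve_left hno) (hl'.resolve_left hno))
  have hW : ∀ i, twoInter (fun j => TT (e i j)) ⊆ P i := by
    intro i x hx
    obtain ⟨k, l, hkl, hk, hl⟩ := (mem_twoInter _ x).1 hx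
    by_contra hno
    have hk' := hT i k hk
    have hl' := hT i l hl
    rw [Finset.mem_union] at hk' hl'
    exact hkl ((hQ x).unique (hk'.resolve_left hno) (hl'.resolve_left hno))
  have h17 : ∀ i, 17 ≤ (P i).card := fun i =>
    (iterated (e i)).trans (Finset.card_le_card (hW i))
  have hdisj : (twoInter P).card = 0 := by
    rw [Finset.card_eq_zero, Finset.eq_empty_iff_forall_notMem]
    intro x hx
    obtain ⟨k, l, hkl, hk, hl⟩ := (mem_twoInter _ x).1 hx
    exact hkl ((hP x).unique hk hl)
  have hc := count4 P
  have h64 : Fintype.card GridPt = 64 := by simp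
  rw [h64, hdisj] at hc
  have a0 := h17 0
  have a1 := h17 1
  have a2 := h17 2
  have a3 := h17 3
  omega
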